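/- Fix real λ > 0, ν > 0 and a natural number k. Then, as the real parameter d tends to 1 with d ≠ 1, the Källén–Lehmann weight ρ(d,k,λ,ν) tends to (λ+ν)/(2λν) if k = 0, and tends to 0 if k ≥ 1. -/

import Mathlib

open Real Filter

/-- The Källén–Lehmann weight `ρ(d,k,λ,ν)`. -/
noncomputable def klWeight (d : ℝ) (k : ℕ) (l v : ℝ) : ℝ :=
  (2 * ((d - 1) / 2) + 4 * k + 2 * l + 2 * v) * Real.Gamma (1 + 2 * k + l + v) /
      (4 * Real.pi ^ ((d - 1) / 2) * Real.Gamma ((d - 1) / 2) *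
        Real.Gamma (2 * ((d - 1) / 2) + 2 * k + l + v)) *
    (Real.Gamma ((d - 1) / 2 + k) * Real.Gamma ((d - 1) / 2 + l + k) *
        Real.Gamma ((d - 1) / 2 + v + k) * Real.Gamma ((d - 1) / 2 + l + v + k) /
      (Real.Gamma (1 + k) * Real.Gamma (1 + l + k) * Real.Gamma (1 + v + k) *
        Real.Gamma (1 + l + v + k)))

/-- The factor of `klWeight` that stays regular at `d = 1`: the weight with the quotient
`Γ(δ+k)/Γ(δ)`, `δ = (d-1)/2`, removed. -/
noncomputable def klWeightRegular (d : ℝ) (k : ℕ) (l v : ℝ) : ℝ :=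
  (2 * ((d - 1) / 2) + 4 * k + 2 * l + 2 * v) * Real.Gamma (1 + 2 * k + l + v) /
      (4 * Real.pi ^ ((d - 1) / 2) * Real.Gamma (2 * ((d - 1) / 2) + 2 * k + l + v)) *
    (Real.Gamma ((d - 1) / 2 + l + k) *
        Real.Gamma ((d - 1) / 2 + v + k) * Real.Gamma ((d - 1) / 2 + l + v + k) /
      (Real.Gamma (1 + k) * Real.Gamma (1 + l + k) * Real.Gamma (1 + v + k) *
        Real.Gamma (1 + l + v + k)))

lemma klWeight_eq_mul_klWeightRegular (d : ℝ) (k : ℕ) (l v : ℝ) :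
    klWeight d k l v = Real.Gamma ((d - 1) / 2 + k) * (Real.Gamma ((d - 1) / 2))⁻¹ *
      klWeightRegular d k l v := by
  unfold klWeight klWeightRegular
  simp only [div_eq_mul_inv, mul_inv]
  ring

lemma continuousAt_Gamma_of_pos {s : ℝ} (hs : 0 < s) : ContinuousAt Real.Gamma s :=
  (Real.differentiableOn_Gamma_Ioi.differentiableAt (Ioi_mem_nhds hs)).continuousAt

lemma ContinuousAt.Gamma_of_pos {X : Type*} [TopologicalSpace X] {f : X → ℝ} {x : X}
    (hf : ContinuousAt f x) (hx : 0 < f x) : ContinuousAt (fun y => Real.Gamma (f y)) x :=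
  ContinuousAt.comp (g := Real.Gamma) (continuousAt_Gamma_of_pos hx) hf

lemma continuousAt_klWeightRegular_one {l v : ℝ} (hl : 0 < l) (hv : 0 < v) (k : ℕ) :
    ContinuousAt (fun d => klWeightRegular d k l v) 1 := by
  have hpos : 0 < 2 * (((1 : ℝ) - 1) / 2) + 2 * k + l + v := by
    norm_num
    positivity
  have hGamma_ne := (Real.Gamma_pos_of_pos hpos).ne'
  have hpow : ContinuousAt (fun d : ℝ => Real.pi ^ ((d - 1) / 2)) 1 :=
    ContinuousAt.rpow continuousAt_const (by fun_prop) (Or.inl Real.pi_ne_zero)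
  unfold klWeightRegular
  refine ContinuousAt.mul (ContinuousAt.div₀ (by fun_prop) ?_ (by positivity))
    (ContinuousAt.div_const (ContinuousAt.mul (ContinuousAt.mul ?_ ?_) ?_) _)
  · exact (continuousAt_const.mul hpow).mul (ContinuousAt.Gamma_of_pos (by fun_prop) hpos)
  all_goals
    refine ContinuousAt.Gamma_of_pos (by fun_prop) ?_
    norm_num
    positivity

lemma klWeightRegular_one_zero {l v : ℝ} (hl : 0 < l) (hv : 0 < v) :
    klWeightRegular 1 0 l v = (l + v) / (2 * l * v) := by
  simp only [klWeightRegular, sub_self, zero_div, mul_zero, zero_add, Nat.cast_zero, add_zero,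
    Real.rpow_zero, Real.Gamma_one, add_assoc, add_comm (1 : ℝ), Real.Gamma_add_one hl.ne',
    Real.Gamma_add_one hv.ne']
  field_simp
  ring

lemma tendsto_inv_Gamma_nhdsNE_zero :
    Tendsto (fun s : ℝ => (Real.Gamma s)⁻¹) (nhdsWithin 0 {(0 : ℝ)}ᶜ) (nhds 0) := by
  have hcont : ContinuousAt (fun s : ℝ => s * (Real.Gamma (s + 1))⁻¹) 0 :=
    continuousAt_id.mul ((ContinuousAt.Gamma_of_pos (by fun_prop) (by norm_num)).inv₀ (by simp))
  have hlim : Tendsto (fun s : ℝ => s * (Real.Gamma (s + 1))⁻¹) (nhds 0) (nhds 0) := by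
    simpa using hcont.tendsto
  refine (hlim.mono_left nhdsWithin_le_nhds).congr' ?_
  filter_upwards [self_mem_nhdsWithin] with s hs
  rw [Real.Gamma_add_one hs, mul_inv, mul_inv_cancel_left₀ hs]

lemma eventually_Gamma_ne_zero_nhdsNE_zero :
    ∀ᶠ s : ℝ in nhdsWithin 0 {(0 : ℝ)}ᶜ, Real.Gamma s ≠ 0 := by
  have hne : ∀ᶠ s : ℝ in nhds 0, Real.Gamma (s + 1) ≠ 0 :=
    (ContinuousAt.Gamma_of_pos (by fun_prop) (by norm_num)).eventually_ne (by simp)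
  filter_upwards [self_mem_nhdsWithin, nhdsWithin_le_nhds hne] with s hs h
  rw [Real.Gamma_add_one hs] at h
  exact right_ne_zero_of_mul h

lemma tendsto_half_sub_one_nhdsNE :
    Tendsto (fun d : ℝ => (d - 1) / 2) (nhdsWithin 1 {(1 : ℝ)}ᶜ) (nhdsWithin 0 {(0 : ℝ)}ᶜ) := by
  refine tendsto_nhdsWithin_iff.mpr ⟨?_, ?_⟩
  · have hcont : ContinuousAt (fun d : ℝ => (d - 1) / 2) 1 := by fun_prop
    simpa using hcont.tendsto.mono_left nhdsWithin_le_nhds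
  · filter_upwards [self_mem_nhdsWithin] with d hd
    exact div_ne_zero (sub_ne_zero.mpr hd) two_ne_zero

/-- As `d → 1` (with `d ≠ 1`), the Källén–Lehmann weight `ρ(d,k,λ,ν)` tends to
`(λ+ν)/(2λν)` for `k = 0` and to `0` for `k ≥ 1`. -/
theorem klWeight_limit_dim_one (lam nu : ℝ) (hlam : 0 < lam) (hnu : 0 < nu) (k : ℕ) :
    (k = 0 →
      Tendsto (fun d : ℝ => klWeight d k lam nu) (nhdsWithin 1 {(1 : ℝ)}ᶜ)
        (nhds ((lam + nu) / (2 * lam * nu)))) ∧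
    (1 ≤ k →
      Tendsto (fun d : ℝ => klWeight d k lam nu) (nhdsWithin 1 {(1 : ℝ)}ᶜ) (nhds 0)) := by
  have hreg := (continuousAt_klWeightRegular_one hlam hnu k).tendsto.mono_left
    (nhdsWithin_le_nhds (s := {(1 : ℝ)}ᶜ))
  constructor
  · rintro rfl
    rw [klWeightRegular_one_zero hlam hnu] at hreg
    refine hreg.congr' ?_
    filter_upwards [tendsto_half_sub_one_nhdsNE.eventually eventually_Gamma_ne_zero_nhdsNE_zero]
      with d hd
    rw [klWeight_eq_mul_klWeightRegular, Nat.cast_zero, add_zero, mul_inv_cancel₀ hd, one_mul]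
  · intro hk
    have hcont : ContinuousAt (fun d : ℝ => Real.Gamma ((d - 1) / 2 + k)) 1 := by
      refine ContinuousAt.Gamma_of_pos (by fun_prop) ?_
      norm_num
      lia
    have hlim := ((hcont.tendsto.mono_left nhdsWithin_le_nhds).mul
      (tendsto_inv_Gamma_nhdsNE_zero.comp tendsto_half_sub_one_nhdsNE)).mul hreg
    simpa [klWeight_eq_mul_klWeightRegular] using hlim
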